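/- Let Z be an n×n invertible complex matrix and let S(Z) = (1/2)·log(Z*Z # conj(Z*Z)), where log denotes the matrix logarithm of a positive definite matrix. Set k(Z) = β(Z)·cond(Z)·(1 + cond(Z)⁴). Then for every η > 0 there exists ε > 0 such that every invertible matrix Z̃ with ‖Z̃ − Z‖ < ε satisfies ‖S(Z̃) − S(Z)‖ ≤ (‖ρ₂(Z)^{-1}‖·k(Z) + η)·‖Z̃ − Z‖. -/

import Mathlib

open Matrix MeasureTheory Real
open scoped Matrix.Norms.L2Operator ComplexOrder

-- `psqrt M` is the unique positive semidefinite square root of a positive semidefinite matrix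
open Classical in
noncomputable def psqrt {n : ℕ} (M : Matrix (Fin n) (Fin n) ℂ) : Matrix (Fin n) (Fin n) ℂ :=
  if h : M.PosSemidef then h.1.cfc Real.sqrt else 0

-- the geometric mean  A#B = A^{1/2} (A^{-1/2} B A^{-1/2})^{1/2} A^{1/2}
noncomputable def gm {n : ℕ} (A B : Matrix (Fin n) (Fin n) ℂ) : Matrix (Fin n) (Fin n) ℂ :=
  psqrt A * psqrt ((psqrt A)⁻¹ * B * (psqrt A)⁻¹) * psqrt A

-- entrywise complex conjugate
def mconj {n : ℕ} (M : Matrix (Fin n) (Fin n) ℂ) : Matrix (Fin n) (Fin n) ℂ := Mᴴᵀ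

-- smallest eigenvalue of a Hermitian matrix
noncomputable def lmin {n : ℕ} {C : Matrix (Fin n) (Fin n) ℂ} (hC : C.IsHermitian) : ℝ :=
  ⨅ i, hC.eigenvalues i

-- ρ₂(Z) = (Z*Z # conj(Z*Z))^{1/2}
noncomputable def rho2 {n : ℕ} (Z : Matrix (Fin n) (Fin n) ℂ) : Matrix (Fin n) (Fin n) ℂ :=
  psqrt (gm (Zᴴ * Z) (mconj (Zᴴ * Z)))

-- C_Z = (Z*Z)⁻¹ (Z*Z # conj(Z*Z))
noncomputable def CZ {n : ℕ} (Z : Matrix (Fin n) (Fin n) ℂ) : Matrix (Fin n) (Fin n) ℂ :=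
  (Zᴴ * Z)⁻¹ * gm (Zᴴ * Z) (mconj (Zᴴ * Z))

-- β(Z) = ∫₀^∞ ‖exp(-t C_Z)‖² dt
noncomputable def beta {n : ℕ} (Z : Matrix (Fin n) (Fin n) ℂ) : ℝ :=
  ∫ t in Set.Ioi (0 : ℝ), ‖NormedSpace.exp ((-t) • CZ Z)‖ ^ 2

-- cond(Z) = ‖Z‖ ‖Z⁻¹‖
noncomputable def condNum {n : ℕ} (Z : Matrix (Fin n) (Fin n) ℂ) : ℝ := ‖Z‖ * ‖Z⁻¹‖

-- Hermitian matrix logarithm of a positive definite matrix, via functional calculus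
open Classical in
noncomputable def mlog {n : ℕ} (P : Matrix (Fin n) (Fin n) ℂ) : Matrix (Fin n) (Fin n) ℂ :=
  if h : P.IsHermitian then h.cfc Real.log else 0

-- S(Z) = (1/2) log (Z*Z # conj(Z*Z))
noncomputable def SZ {n : ℕ} (Z : Matrix (Fin n) (Fin n) ℂ) : Matrix (Fin n) (Fin n) ℂ :=
  (1 / 2 : ℂ) • mlog (gm (Zᴴ * Z) (mconj (Zᴴ * Z)))

-- k(Z) = β(Z) cond(Z) (1 + cond(Z)⁴)
noncomputable def kZ {n : ℕ} (Z : Matrix (Fin n) (Fin n) ℂ) : ℝ :=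
  beta Z * condNum Z * (1 + condNum Z ^ 4)


section generic

lemma aux_norm_le {A : Type*} [CStarAlgebra A] [PartialOrder A] [StarOrderedRing A]
    {x : A} {r : ℝ} (hx : IsSelfAdjoint x) (hr : 0 ≤ r)
    (h1 : x ≤ algebraMap ℝ A r) (h2 : -x ≤ algebraMap ℝ A r) : ‖x‖ ≤ r := by
  have h1' := (le_algebraMap_iff_spectrum_le (a := x) (r := r) hx).1 h1
  have h2' := (algebraMap_le_iff_le_spectrum (a := x) (r := -r) hx).1 (by
    rw [map_neg]; exact neg_le.1 h2)
  rw [← cfc_id ℝ x hx]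
  apply norm_cfc_le hr
  intro y hy
  rw [id, Real.norm_eq_abs, abs_le]
  exact ⟨h2' y hy, h1' y hy⟩

lemma aux_one_le {A : Type*} [CStarAlgebra A] [PartialOrder A] [StarOrderedRing A]
    {p w : A} (hp : IsStrictlyPositive p) (h1 : p * w = 1) {c : ℝ}
    (hc : ‖w‖ ≤ c) : 1 ≤ c • p := by
  have hps : IsSelfAdjoint p := hp.isSelfAdjoint
  have hws : IsSelfAdjoint w := by
    have : star w * p = 1 := by
      have := congrArg star h1
      rwa [star_mul, hps.star_eq, star_one] at this
    calc star w = star w * (p * w) := by rw [h1, mul_one]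
      _ = w := by rw [← mul_assoc, this, one_mul]
  have hw : w ≤ algebraMap ℝ A c :=
    hws.le_algebraMap_norm_self.trans (algebraMap_mono A hc)
  have hs := CFC.sqrt_mul_sqrt_self p hp.nonneg
  have hss : IsSelfAdjoint (CFC.sqrt p) := (CFC.sqrt_nonneg p).isSelfAdjoint
  have := star_left_conjugate_le_conjugate hw (CFC.sqrt p)
  rw [hss.star_eq, Algebra.algebraMap_eq_smul_one, mul_smul_comm, smul_mul_assoc, mul_one, hs] at this
  refine le_trans (le_of_eq ?_) this
  set s := CFC.sqrt p with hs_def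
  have hsu : IsUnit s := (CFC.isUnit_sqrt_iff p hp.nonneg).2 hp.isUnit
  have e : s * (s * w) = 1 := by rw [← mul_assoc, hs, h1]
  have e2 : s * (s * w * s) = s * 1 := by
    rw [← mul_assoc, e, one_mul, mul_one]
  have e3 := hsu.mul_left_cancel e2
  exact e3.symm

lemma aux_log_le {A : Type*} [CStarAlgebra A] [PartialOrder A] [StarOrderedRing A]
    {p q : A} (hp : IsStrictlyPositive p) (hq : IsStrictlyPositive q) {c : ℝ} (hc : 0 ≤ c)
    (h : 1 ≤ c • q) : CFC.log p - CFC.log q ≤ algebraMap ℝ A (c * ‖p - q‖) := by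
  have hd : 0 ≤ ‖p - q‖ := norm_nonneg _
  have hsa : IsSelfAdjoint (p - q) := hp.isSelfAdjoint.sub hq.isSelfAdjoint
  have h1 : p ≤ (1 + c * ‖p - q‖) • q := by
    have a1 := hsa.le_algebraMap_norm_self
    have a2 : ‖p - q‖ • (1 : A) ≤ ‖p - q‖ • (c • q) := smul_le_smul_of_nonneg_left h hd
    rw [Algebra.algebraMap_eq_smul_one] at a1
    have a3 := sub_le_iff_le_add.1 (a1.trans a2)
    refine a3.trans (le_of_eq ?_)
    rw [smul_smul, add_smul, one_smul, add_comm, mul_comm]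
  have hpos : 0 < 1 + c * ‖p - q‖ := by positivity
  have h2 := CFC.log_le_log h1 hp
  rw [CFC.log_smul' q hpos hq] at h2
  rw [sub_le_iff_le_add]
  refine h2.trans (add_le_add_left ?_ _)
  apply algebraMap_mono A
  have := Real.log_le_sub_one_of_pos hpos
  linarith

lemma aux_log {A : Type*} [CStarAlgebra A] [PartialOrder A] [StarOrderedRing A]
    {p q : A} (hp : IsStrictlyPositive p) (hq : IsStrictlyPositive q) {c : ℝ} (hc : 0 ≤ c)
    (h : 1 ≤ c • q) (h' : 1 ≤ c • p) : ‖CFC.log p - CFC.log q‖ ≤ c * ‖p - q‖ := by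
  apply aux_norm_le (IsSelfAdjoint.log.sub IsSelfAdjoint.log) (by positivity)
  · exact aux_log_le hp hq hc h
  · rw [neg_sub, norm_sub_rev]; exact aux_log_le hq hp hc h'

lemma aux_exp {A : Type*} [CStarAlgebra A] [PartialOrder A] [StarOrderedRing A]
    {H : A} (hH : IsStrictlyPositive H) :
    ∃ l : ℝ, 0 < l ∧ ∀ t : ℝ, 0 ≤ t → ‖NormedSpace.exp ((-t) • H)‖ ≤ Real.exp (-l * t) := by
  obtain h0 | h0 := subsingleton_or_nontrivial A
  · refine ⟨1, one_pos, fun t _ => ?_⟩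
    rw [Subsingleton.elim (NormedSpace.exp ((-t) • H)) 0, norm_zero]
    positivity
  obtain ⟨l, hl, hle⟩ := (CFC.exists_pos_algebraMap_le_iff (A := A) hH.isSelfAdjoint).2
    (fun x hx => hH.spectrum_pos hx)
  refine ⟨l, hl, fun t ht => ?_⟩
  have hs := (algebraMap_le_iff_le_spectrum (a := H) (r := l) hH.isSelfAdjoint).1 hle
  have hsa : IsSelfAdjoint H := hH.isSelfAdjoint
  rw [← CFC.real_exp_eq_normedSpace_exp (IsSelfAdjoint.smul (IsSelfAdjoint.all (-t)) hsa),
    ← cfc_comp_smul (-t) Real.exp H (by fun_prop) hsa]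
  apply norm_cfc_le (Real.exp_nonneg _)
  intro x hx
  rw [Real.norm_eq_abs, Real.abs_exp, Real.exp_le_exp, smul_eq_mul]
  have := hs x hx
  nlinarith

lemma aux_lyap {A : Type*} [CStarAlgebra A] {C X F : A} {K l : ℝ} (hl : 0 < l)
    (hC : ∀ t : ℝ, 0 ≤ t → ‖NormedSpace.exp ((-t) • C)‖ ≤ K * Real.exp (-l * t))
    (hX : star C * X + X * C = F) :
    ‖X‖ ≤ (∫ t in Set.Ioi (0 : ℝ), ‖NormedSpace.exp ((-t) • C)‖ ^ 2) * ‖F‖ := by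
  set E : ℝ → A := fun t => NormedSpace.exp ((-t) • C) with hE
  have hcE : Continuous E := by
    let _ : NormedAlgebra ℚ A := .restrictScalars ℚ ℂ A
    have : Continuous fun x : A => NormedSpace.exp x := NormedSpace.exp_continuous
    exact this.comp (by fun_prop)
  have hdE : ∀ t, HasDerivAt E (-(E t * C)) t := by
    intro t
    have h1 := hasDerivAt_exp_smul_const (𝕂 := ℝ) C (-t)
    have h2 := h1.scomp t (hasDerivAt_neg t)
    have h3 : HasDerivAt E ((-1 : ℝ) • (E t * C)) t := by
      simpa only [Function.comp_def] using h2
    simpa only [neg_smul, one_smul] using h3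
  have hcomm : ∀ t, E t * C = C * E t := by
    intro t
    have : Commute ((-t) • C) C := (Commute.refl C).smul_left _
    exact this.exp_left
  have hdS : ∀ t, HasDerivAt (fun t => star (E t)) (-(star C * star (E t))) t := by
    intro t
    have := (hdE t).star
    simpa using this
  set f : ℝ → A := fun t => star (E t) * X * E t with hf
  have hdf : ∀ t, HasDerivAt f (-(star (E t) * F * E t)) t := by
    intro t
    have := ((hdS t).mul_const X).mul (hdE t)
    refine this.congr_deriv ?_
    have hc2 : star C * star (E t) = star (E t) * star C := by
      rw [← star_mul, ← star_mul, hcomm]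
    rw [hc2, hcomm, ← hX]
    noncomm_ring
  have hK : 0 ≤ K := by
    have := (norm_nonneg _).trans (hC 0 le_rfl)
    simpa using this
  have hb : ∀ t, 0 ≤ t → ‖E t‖ ^ 2 ≤ K ^ 2 * Real.exp (-(2 * l) * t) := by
    intro t ht
    calc ‖E t‖ ^ 2 ≤ (K * Real.exp (-l * t)) ^ 2 := by
          gcongr; exact hC t ht
      _ = _ := by rw [mul_pow, ← Real.exp_nat_mul]; congr 2; push_cast; ring
  have hbound : ∀ Y : A, ∀ t, ‖star (E t) * Y * E t‖ ≤ ‖E t‖ ^ 2 * ‖Y‖ := by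
    intro Y t
    calc _ ≤ ‖star (E t)‖ * ‖Y‖ * ‖E t‖ := (norm_mul_le _ _).trans (by gcongr; exact norm_mul_le _ _)
      _ = _ := by rw [norm_star]; ring
  have hie : MeasureTheory.IntegrableOn (fun t : ℝ => K ^ 2 * Real.exp (-(2 * l) * t)) (Set.Ioi 0) :=
    (integrableOn_exp_mul_Ioi (by linarith) 0).const_mul _
  have hi : MeasureTheory.IntegrableOn (fun t : ℝ => ‖E t‖ ^ 2) (Set.Ioi 0) := by
    refine MeasureTheory.Integrable.mono' hie (by fun_prop) ?_
    refine (MeasureTheory.ae_restrict_mem measurableSet_Ioi).mono fun t ht => ?_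
    rw [Real.norm_of_nonneg (by positivity)]
    exact hb t (le_of_lt ht)
  have hcS : Continuous fun t => star (E t) * F * E t := by
    exact ((continuous_star.comp hcE).mul continuous_const).mul hcE
  have hi2 : MeasureTheory.IntegrableOn (fun t : ℝ => star (E t) * F * E t) (Set.Ioi 0) := by
    refine MeasureTheory.Integrable.mono' (hi.mul_const ‖F‖) hcS.aestronglyMeasurable ?_
    exact Filter.Eventually.of_forall fun t => hbound F t
  have hlim : Filter.Tendsto f Filter.atTop (nhds 0) := by
    have h0 : Filter.Tendsto (fun t : ℝ => K ^ 2 * Real.exp (-(2 * l) * t) * ‖X‖) Filter.atTop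
        (nhds (K ^ 2 * 0 * ‖X‖)) := by
      refine (Filter.Tendsto.const_mul _ ?_).mul_const _
      refine Real.tendsto_exp_atBot.comp ?_
      exact Filter.tendsto_id.const_mul_atTop_of_neg (by linarith)
    rw [mul_zero, zero_mul] at h0
    refine squeeze_zero_norm' ?_ h0
    filter_upwards [Filter.eventually_ge_atTop 0] with t ht
    exact (hbound X t).trans (by gcongr; exact hb t ht)
  have hint := MeasureTheory.integral_Ioi_of_hasDerivAt_of_tendsto' (a := 0)
    (fun t _ => hdf t) hi2.neg hlim
  have hf0 : f 0 = X := by simp [f, E]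
  rw [hf0, MeasureTheory.integral_neg, zero_sub, neg_inj] at hint
  rw [← hint, ← MeasureTheory.integral_mul_const]
  refine MeasureTheory.norm_integral_le_of_norm_le (hi.mul_const ‖F‖) ?_
  exact Filter.Eventually.of_forall fun t => hbound F t

end generic

section matrixpart

open scoped MatrixOrder

lemma psqrt_eq {n : ℕ} {M : Matrix (Fin n) (Fin n) ℂ} (h : M.PosSemidef) :
    psqrt M = CFC.sqrt M := by
  rw [psqrt, dif_pos h, CFC.sqrt_eq_real_sqrt M (Matrix.nonneg_iff_posSemidef.2 h),
    cfcₙ_eq_cfc, Matrix.IsHermitian.cfc_eq h.1]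

lemma psqrt_mul {n : ℕ} {M : Matrix (Fin n) (Fin n) ℂ} (h : M.PosSemidef) :
    psqrt M * psqrt M = M := by
  rw [psqrt_eq h]
  exact CFC.sqrt_mul_sqrt_self M (Matrix.nonneg_iff_posSemidef.2 h)

lemma psqrt_psd {n : ℕ} {M : Matrix (Fin n) (Fin n) ℂ} (h : M.PosSemidef) :
    (psqrt M).PosSemidef := by
  rw [psqrt_eq h]
  exact Matrix.nonneg_iff_posSemidef.1 (CFC.sqrt_nonneg M)

lemma psqrt_posDef {n : ℕ} {M : Matrix (Fin n) (Fin n) ℂ} (h : M.PosDef) :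
    (psqrt M).PosDef := by
  rw [psqrt_eq h.posSemidef]
  exact Matrix.isStrictlyPositive_iff_posDef.1
    (IsStrictlyPositive.sqrt M (Matrix.isStrictlyPositive_iff_posDef.2 h))

lemma mlog_eq {n : ℕ} {M : Matrix (Fin n) (Fin n) ℂ} (h : M.PosDef) :
    mlog M = CFC.log M := by
  rw [mlog, dif_pos h.1, CFC.log, Matrix.IsHermitian.cfc_eq h.1]

lemma conj_posDef {n : ℕ} {M P : Matrix (Fin n) (Fin n) ℂ} (h : M.PosDef) (hP : IsUnit P) :
    (Pᴴ * M * P).PosDef := by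
  exact (Matrix.IsUnit.posDef_star_left_conjugate_iff hP).2 h

lemma gm_posDef {n : ℕ} {A B : Matrix (Fin n) (Fin n) ℂ} (hA : A.PosDef) (hB : B.PosDef) :
    (gm A B).PosDef := by
  have h1 := psqrt_posDef hA
  have h2 : ((psqrt A)⁻¹ * B * (psqrt A)⁻¹).PosDef := by
    have := conj_posDef hB (P := (psqrt A)⁻¹) h1.inv.isUnit
    rwa [h1.inv.1.eq] at this
  have := conj_posDef (psqrt_posDef h2) (P := psqrt A) h1.isUnit
  rwa [h1.1.eq] at this

lemma gm_riccati {n : ℕ} {A B : Matrix (Fin n) (Fin n) ℂ} (hA : A.PosDef) (hB : B.PosDef) :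
    gm A B * A⁻¹ * gm A B = B := by
  have h1 := psqrt_posDef hA
  have h2 : ((psqrt A)⁻¹ * B * (psqrt A)⁻¹).PosDef := by
    have := conj_posDef hB (P := (psqrt A)⁻¹) h1.inv.isUnit
    rwa [h1.inv.1.eq] at this
  have h3 := psqrt_mul h2.posSemidef
  have hAi : A⁻¹ = (psqrt A)⁻¹ * (psqrt A)⁻¹ := by
    rw [← Matrix.mul_inv_rev, psqrt_mul hA.posSemidef]
  have hd : IsUnit (psqrt A).det := (Matrix.isUnit_iff_isUnit_det _).1 h1.isUnit
  have e1 := Matrix.mul_nonsing_inv (psqrt A) hd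
  have e2 := Matrix.nonsing_inv_mul (psqrt A) hd
  rw [hAi, gm]
  set s := psqrt A
  set w := s⁻¹
  set r := psqrt (w * B * w)
  calc s * r * s * (w * w) * (s * r * s) = s * r * (s * w) * (w * s) * r * s := by noncomm_ring
    _ = s * (r * r) * s := by rw [e1, e2]; noncomm_ring
    _ = (s * w) * B * (w * s) := by rw [h3]; noncomm_ring
    _ = B := by rw [e1, e2]; noncomm_ring

lemma mconj_mul {n : ℕ} (A B : Matrix (Fin n) (Fin n) ℂ) : mconj (A * B) = mconj A * mconj B := by
  simp [mconj, Matrix.conjTranspose_mul, Matrix.transpose_mul]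

lemma mconj_ct {n : ℕ} (A : Matrix (Fin n) (Fin n) ℂ) : mconj (Aᴴ) = (mconj A)ᴴ := by
  simp only [mconj]
  ext i j
  simp

lemma mconj_mconj {n : ℕ} (A : Matrix (Fin n) (Fin n) ℂ) : mconj (mconj A) = A := by
  simp only [mconj]
  ext i j
  simp

lemma mconj_one {n : ℕ} : mconj (1 : Matrix (Fin n) (Fin n) ℂ) = 1 := by
  simp [mconj]

lemma mconj_sub {n : ℕ} (A B : Matrix (Fin n) (Fin n) ℂ) : mconj (A - B) = mconj A - mconj B := by
  simp [mconj]

lemma mconj_continuous {n : ℕ} : Continuous (mconj : Matrix (Fin n) (Fin n) ℂ → _) := by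
  unfold mconj
  fun_prop

lemma norm_mconj_le {n : ℕ} (A : Matrix (Fin n) (Fin n) ℂ) : ‖mconj A‖ ≤ ‖A‖ := by
  rw [Matrix.l2_opNorm_def]
  refine ContinuousLinearMap.opNorm_le_bound _ (norm_nonneg _) fun x => ?_
  have key : ∀ y : EuclideanSpace ℂ (Fin n), ‖(WithLp.toLp 2 (star y.ofLp) : EuclideanSpace ℂ (Fin n))‖ = ‖y‖ := by
    intro y
    simp [EuclideanSpace.norm_eq]
  have h := Matrix.l2_opNorm_mulVec A (WithLp.toLp 2 (star x.ofLp))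
  rw [key] at h
  refine le_trans (le_of_eq ?_) h
  rw [← key]
  congr 1
  ext i
  simp [mconj, Matrix.mulVec, dotProduct]

lemma isUnit_mconj {n : ℕ} {Z : Matrix (Fin n) (Fin n) ℂ} (hZ : IsUnit Z) : IsUnit (mconj Z) := by
  obtain ⟨u, rfl⟩ := hZ
  refine ⟨⟨mconj u, mconj (↑u⁻¹ : Matrix _ _ ℂ), ?_, ?_⟩, rfl⟩
  · rw [← mconj_mul, Units.mul_inv, mconj_one]
  · rw [← mconj_mul, Units.inv_mul, mconj_one]

lemma posDef_ctmul {n : ℕ} {Z : Matrix (Fin n) (Fin n) ℂ} (hZ : IsUnit Z) : (Zᴴ * Z).PosDef := by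
  have := conj_posDef Matrix.PosDef.one hZ
  rwa [mul_one] at this

lemma mconj_ctmul {n : ℕ} (Z : Matrix (Fin n) (Fin n) ℂ) :
    mconj (Zᴴ * Z) = (mconj Z)ᴴ * mconj Z := by
  rw [mconj_mul, mconj_ct]

noncomputable def GG {n : ℕ} (Z : Matrix (Fin n) (Fin n) ℂ) : Matrix (Fin n) (Fin n) ℂ :=
  gm (Zᴴ * Z) (mconj (Zᴴ * Z))

lemma GG_posDef {n : ℕ} {Z : Matrix (Fin n) (Fin n) ℂ} (hZ : IsUnit Z) : (GG Z).PosDef := by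
  apply gm_posDef (posDef_ctmul hZ)
  rw [mconj_ctmul]
  exact posDef_ctmul (isUnit_mconj hZ)

lemma GG_riccati {n : ℕ} {Z : Matrix (Fin n) (Fin n) ℂ} (hZ : IsUnit Z) :
    GG Z * (Zᴴ * Z)⁻¹ * GG Z = mconj (Zᴴ * Z) := by
  apply gm_riccati (posDef_ctmul hZ)
  rw [mconj_ctmul]
  exact posDef_ctmul (isUnit_mconj hZ)

lemma inv_continuousAt {n : ℕ} {Z : Matrix (Fin n) (Fin n) ℂ} (hZ : IsUnit Z) :
    ContinuousAt (fun M : Matrix (Fin n) (Fin n) ℂ => M⁻¹) Z := by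
  have : (fun M : Matrix (Fin n) (Fin n) ℂ => M⁻¹) = Ring.inverse := by
    funext M; exact Matrix.nonsing_inv_eq_ringInverse M
  rw [this]
  obtain ⟨u, rfl⟩ := hZ
  exact NormedRing.inverse_continuousAt u

lemma psqrt_continuousAt {n : ℕ} {f : Matrix (Fin n) (Fin n) ℂ → Matrix (Fin n) (Fin n) ℂ}
    (hf : ∀ X, (f X).PosSemidef) {Z : Matrix (Fin n) (Fin n) ℂ} (hc : ContinuousAt f Z) :
    ContinuousAt (fun X => psqrt (f X)) Z := by
  have : (fun X => psqrt (f X)) = fun X => CFC.sqrt (f X) := by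
    funext X; exact psqrt_eq (hf X)
  rw [this]
  have h := CFC.continuousOn_sqrt (A := Matrix (Fin n) (Fin n) ℂ)
  have h2 : ContinuousWithinAt CFC.sqrt {a : Matrix (Fin n) (Fin n) ℂ | 0 ≤ a} (f Z) :=
    h (f Z) (Matrix.nonneg_iff_posSemidef.2 (hf Z))
  refine Filter.Tendsto.comp h2 ?_
  refine tendsto_nhdsWithin_iff.2 ⟨hc, Filter.Eventually.of_forall fun X => ?_⟩
  exact Matrix.nonneg_iff_posSemidef.2 (hf X)

lemma GG_continuousAt {n : ℕ} {Z : Matrix (Fin n) (Fin n) ℂ} (hZ : IsUnit Z) :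
    ContinuousAt (GG (n := n)) Z := by
  have hA : ContinuousAt (fun X : Matrix (Fin n) (Fin n) ℂ => Xᴴ * X) Z := by fun_prop
  have hs : ContinuousAt (fun X : Matrix (Fin n) (Fin n) ℂ => psqrt (Xᴴ * X)) Z :=
    psqrt_continuousAt (fun X => Matrix.posSemidef_conjTranspose_mul_self X) hA
  have hi : ContinuousAt (fun X : Matrix (Fin n) (Fin n) ℂ => (psqrt (Xᴴ * X))⁻¹) Z :=
    ContinuousAt.comp (f := fun X : Matrix (Fin n) (Fin n) ℂ => psqrt (Xᴴ * X))
      (inv_continuousAt (psqrt_posDef (posDef_ctmul hZ)).isUnit) hs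
  have hB : ContinuousAt (fun X : Matrix (Fin n) (Fin n) ℂ => mconj (Xᴴ * X)) Z :=
    mconj_continuous.continuousAt.comp hA
  have hm : ContinuousAt (fun X : Matrix (Fin n) (Fin n) ℂ =>
      psqrt ((psqrt (Xᴴ * X))⁻¹ * mconj (Xᴴ * X) * (psqrt (Xᴴ * X))⁻¹)) Z := by
    refine psqrt_continuousAt (fun X => ?_) ((hi.mul hB).mul hi)
    have h1 : (psqrt (Xᴴ * X)).PosSemidef :=
      psqrt_psd (Matrix.posSemidef_conjTranspose_mul_self X)
    have h2 : (mconj (Xᴴ * X)).PosSemidef := by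
      rw [mconj_ctmul]; exact Matrix.posSemidef_conjTranspose_mul_self _
    have := h2.conjTranspose_mul_mul_same ((psqrt (Xᴴ * X))⁻¹)
    rwa [h1.inv.1.eq] at this
  exact (hs.mul hm).mul hs

end matrixpart

section finalpart

open scoped MatrixOrder

lemma ctmul_inv {n : ℕ} (Z : Matrix (Fin n) (Fin n) ℂ) : (Zᴴ * Z)⁻¹ = Z⁻¹ * (Z⁻¹)ᴴ := by
  rw [Matrix.mul_inv_rev, Matrix.conjTranspose_nonsing_inv]

lemma norm_GGinv {n : ℕ} {Z : Matrix (Fin n) (Fin n) ℂ} (hZ : IsUnit Z) :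
    ‖(GG Z)⁻¹‖ ≤ ‖Z⁻¹‖ * ‖Z⁻¹‖ := by
  have hG := GG_posDef hZ
  have hr := GG_riccati hZ
  have hGd : IsUnit (GG Z).det := (Matrix.isUnit_iff_isUnit_det _).1 hG.isUnit
  have hZd : IsUnit Z.det := (Matrix.isUnit_iff_isUnit_det _).1 hZ
  have e1 := Matrix.mul_nonsing_inv (GG Z) hGd
  have e2 := Matrix.nonsing_inv_mul (GG Z) hGd
  have e3 := Matrix.nonsing_inv_mul Z hZd
  have hGi : ((GG Z)⁻¹)ᴴ = (GG Z)⁻¹ := hG.inv.1.eq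
  set G := GG Z
  set Gi := G⁻¹
  have h1 : (mconj Z * Gi)ᴴ * (mconj Z * Gi) = Z⁻¹ * (Z⁻¹)ᴴ := by
    rw [← ctmul_inv, Matrix.conjTranspose_mul, hGi]
    calc Gi * (mconj Z)ᴴ * (mconj Z * Gi) = Gi * ((mconj Z)ᴴ * mconj Z) * Gi := by noncomm_ring
      _ = (Gi * G) * (Zᴴ * Z)⁻¹ * (G * Gi) := by rw [← mconj_ctmul, ← hr]; noncomm_ring
      _ = _ := by rw [e1, e2, one_mul, mul_one]
  have h2 : ‖mconj Z * Gi‖ ≤ ‖Z⁻¹‖ := by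
    have := Matrix.l2_opNorm_conjTranspose_mul_self (mconj Z * Gi)
    rw [h1] at this
    have h3 := norm_mul_le Z⁻¹ (Z⁻¹)ᴴ
    rw [Matrix.l2_opNorm_conjTranspose, this] at h3
    exact abs_le_of_sq_le_sq' (by nlinarith) (norm_nonneg _) |>.2
  have h4 : Gi = mconj Z⁻¹ * (mconj Z * Gi) := by
    rw [← mul_assoc, ← mconj_mul, e3, mconj_one, one_mul]
  rw [h4]
  refine (norm_mul_le _ _).trans ?_
  gcongr
  exact norm_mconj_le _

lemma norm_rho2inv {n : ℕ} {Z : Matrix (Fin n) (Fin n) ℂ} (hZ : IsUnit Z) :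
    ‖(GG Z)⁻¹‖ = ‖(rho2 Z)⁻¹‖ * ‖(rho2 Z)⁻¹‖ := by
  have hG := GG_posDef hZ
  have h1 : rho2 Z * rho2 Z = GG Z := psqrt_mul hG.posSemidef
  have h2 : (rho2 Z).PosDef := psqrt_posDef hG
  rw [← Matrix.l2_opNorm_conjTranspose_mul_self, h2.inv.1.eq, ← Matrix.mul_inv_rev, h1]

noncomputable def HH {n : ℕ} (Z : Matrix (Fin n) (Fin n) ℂ) : Matrix (Fin n) (Fin n) ℂ :=
  (Z⁻¹)ᴴ * GG Z * Z⁻¹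

lemma HH_posDef {n : ℕ} {Z : Matrix (Fin n) (Fin n) ℂ} (hZ : IsUnit Z) : (HH Z).PosDef :=
  conj_posDef (GG_posDef hZ) (Matrix.isUnit_nonsing_inv_iff.2 hZ)

lemma CZ_eq {n : ℕ} {Z : Matrix (Fin n) (Fin n) ℂ} (hZ : IsUnit Z) :
    CZ Z = Z⁻¹ * HH Z * Z := by
  have hZd : IsUnit Z.det := (Matrix.isUnit_iff_isUnit_det _).1 hZ
  have e3 := Matrix.nonsing_inv_mul Z hZd
  change (Zᴴ * Z)⁻¹ * GG Z = _
  rw [ctmul_inv, HH]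
  calc _ = Z⁻¹ * (Z⁻¹)ᴴ * GG Z * (Z⁻¹ * Z) := by rw [e3, mul_one]
    _ = _ := by noncomm_ring

lemma norm_HH {n : ℕ} {Z : Matrix (Fin n) (Fin n) ℂ} (hZ : IsUnit Z) :
    ‖HH Z‖ ≤ condNum Z := by
  have h1 : (HH Z)ᴴ * HH Z = (mconj Z * Z⁻¹)ᴴ * (mconj Z * Z⁻¹) := by
    rw [(HH_posDef hZ).1.eq, HH, Matrix.conjTranspose_mul]
    calc _ = (Z⁻¹)ᴴ * (GG Z * (Z⁻¹ * (Z⁻¹)ᴴ) * GG Z) * Z⁻¹ := by noncomm_ring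
      _ = _ := by rw [← ctmul_inv, GG_riccati hZ, mconj_ctmul]; noncomm_ring
  have h2 := congrArg norm h1
  rw [Matrix.l2_opNorm_conjTranspose_mul_self, Matrix.l2_opNorm_conjTranspose_mul_self] at h2
  have h3 : ‖HH Z‖ = ‖mconj Z * Z⁻¹‖ :=
    (mul_self_inj_of_nonneg (norm_nonneg _) (norm_nonneg _)).1 h2
  rw [h3, condNum]
  refine (norm_mul_le _ _).trans ?_
  gcongr
  exact norm_mconj_le _

lemma norm_CZ {n : ℕ} {Z : Matrix (Fin n) (Fin n) ℂ} (hZ : IsUnit Z) :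
    ‖CZ Z‖ ≤ condNum Z ^ 2 := by
  rw [CZ_eq hZ]
  calc _ ≤ ‖Z⁻¹‖ * ‖HH Z‖ * ‖Z‖ := (norm_mul_le _ _).trans (by gcongr; exact norm_mul_le _ _)
    _ ≤ ‖Z⁻¹‖ * condNum Z * ‖Z‖ := by gcongr; exact norm_HH hZ
    _ = _ := by rw [condNum]; ring

lemma exp_CZ {n : ℕ} {Z : Matrix (Fin n) (Fin n) ℂ} (hZ : IsUnit Z) :
    ∃ l : ℝ, 0 < l ∧ ∀ t : ℝ, 0 ≤ t →
      ‖NormedSpace.exp ((-t) • CZ Z)‖ ≤ condNum Z * Real.exp (-l * t) := by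
  obtain ⟨l, hl, h⟩ := aux_exp (Matrix.isStrictlyPositive_iff_posDef.2 (HH_posDef hZ))
  refine ⟨l, hl, fun t ht => ?_⟩
  have e : (-t) • CZ Z = Z⁻¹ * ((-t) • HH Z) * Z := by
    rw [CZ_eq hZ, Matrix.mul_smul, Matrix.smul_mul]
  rw [e, Matrix.exp_conj' Z _ hZ]
  calc _ ≤ ‖Z⁻¹‖ * ‖NormedSpace.exp ((-t) • HH Z)‖ * ‖Z‖ :=
        (norm_mul_le _ _).trans (by gcongr; exact norm_mul_le _ _)
    _ ≤ ‖Z⁻¹‖ * Real.exp (-l * t) * ‖Z‖ := by gcongr; exact h t ht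
    _ = _ := by rw [condNum]; ring

lemma beta_nonneg {n : ℕ} (Z : Matrix (Fin n) (Fin n) ℂ) : 0 ≤ beta Z := by
  unfold beta
  positivity

lemma norm_dA {n : ℕ} (Z Z' : Matrix (Fin n) (Fin n) ℂ) :
    ‖Z'ᴴ * Z' - Zᴴ * Z‖ ≤ (‖Z'‖ + ‖Z‖) * ‖Z' - Z‖ := by
  have : Z'ᴴ * Z' - Zᴴ * Z = Z'ᴴ * (Z' - Z) + (Z' - Z)ᴴ * Z := by
    rw [Matrix.conjTranspose_sub]; noncomm_ring
  rw [this]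
  calc _ ≤ ‖Z'ᴴ‖ * ‖Z' - Z‖ + ‖(Z' - Z)ᴴ‖ * ‖Z‖ :=
        (norm_add_le _ _).trans (add_le_add (norm_mul_le _ _) (norm_mul_le _ _))
    _ = _ := by rw [Matrix.l2_opNorm_conjTranspose, Matrix.l2_opNorm_conjTranspose]; ring

/-- The key estimate on the difference of the geometric means. -/
lemma norm_dG {n : ℕ} {Z Z' : Matrix (Fin n) (Fin n) ℂ} (hZ : IsUnit Z) (hZ' : IsUnit Z') :
    ‖GG Z' - GG Z‖ ≤ beta Z * ((‖Z'‖ + ‖Z‖) * ‖Z' - Z‖ *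
      (1 + ‖GG Z' * (Z'ᴴ * Z')⁻¹‖ * ‖(Zᴴ * Z)⁻¹ * GG Z'‖)
      + ‖GG Z' - GG Z‖ * ‖(Zᴴ * Z)⁻¹‖ * ‖GG Z' - GG Z‖) := by
  obtain ⟨l, hl, hexp⟩ := exp_CZ hZ
  have hr := GG_riccati hZ
  have hr' := GG_riccati hZ'
  have hA := posDef_ctmul hZ
  have hA' := posDef_ctmul hZ'
  have hAd : IsUnit (Zᴴ * Z).det := (Matrix.isUnit_iff_isUnit_det _).1 hA.isUnit
  have hAd' : IsUnit (Z'ᴴ * Z').det := (Matrix.isUnit_iff_isUnit_det _).1 hA'.isUnit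
  have e1 := Matrix.mul_nonsing_inv _ hAd
  have e2 := Matrix.nonsing_inv_mul _ hAd'
  have hCs : star (CZ Z) = GG Z * (Zᴴ * Z)⁻¹ := by
    change ((Zᴴ * Z)⁻¹ * GG Z)ᴴ = _
    rw [Matrix.conjTranspose_mul, hA.inv.1.eq, (GG_posDef hZ).1.eq]
  have hC : CZ Z = (Zᴴ * Z)⁻¹ * GG Z := rfl
  have hdA := norm_dA Z Z'
  have key := aux_lyap (X := GG Z' - GG Z) hl hexp rfl
  refine key.trans (mul_le_mul_of_nonneg_left ?_ (beta_nonneg Z))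
  rw [hCs, hC]
  have hmc : ‖mconj (Z'ᴴ * Z') - mconj (Zᴴ * Z)‖ ≤ ‖Z'ᴴ * Z' - Zᴴ * Z‖ := by
    rw [← mconj_sub]; exact norm_mconj_le _
  rw [← hr, ← hr'] at hmc
  clear key hexp hCs hC hr hr' hA hA' hAd hAd'
  set A := Zᴴ * Z
  set A' := Z'ᴴ * Z'
  set G := GG Z
  set G' := GG Z'
  set P := A⁻¹
  set P' := A'⁻¹
  have hK : P' - P = -(P' * (A' - A) * P) := by
    rw [mul_sub, sub_mul, e2, one_mul, mul_assoc P' A P, e1, mul_one]; abel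
  have hF : G * P * (G' - G) + (G' - G) * (P * G)
      = (G' * P' * G' - G * P * G) + (G' * P') * (A' - A) * (P * G') - (G' - G) * P * (G' - G) := by
    have : (G' * P') * (A' - A) * (P * G') = -(G' * (P' - P) * G') := by rw [hK]; noncomm_ring
    rw [this]; noncomm_ring
  rw [hF]
  calc _ ≤ ‖G' * P' * G' - G * P * G‖ + ‖(G' * P') * (A' - A) * (P * G')‖
          + ‖(G' - G) * P * (G' - G)‖ :=
        (norm_sub_le _ _).trans (add_le_add_left (norm_add_le _ _) _)
    _ ≤ ‖A' - A‖ + ‖G' * P'‖ * ‖A' - A‖ * ‖P * G'‖ + ‖G' - G‖ * ‖P‖ * ‖G' - G‖ := by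
        refine add_le_add (add_le_add hmc ?_) ?_
        · exact (norm_mul_le _ _).trans
            (mul_le_mul_of_nonneg_right (norm_mul_le _ _) (norm_nonneg _))
        · exact (norm_mul_le _ _).trans
            (mul_le_mul_of_nonneg_right (norm_mul_le _ _) (norm_nonneg _))
    _ = ‖A' - A‖ * (1 + ‖G' * P'‖ * ‖P * G'‖) + ‖G' - G‖ * ‖P‖ * ‖G' - G‖ := by ring
    _ ≤ _ := add_le_add_left (mul_le_mul_of_nonneg_right hdA (by positivity)) _

lemma norm_dS {n : ℕ} {Z Z' : Matrix (Fin n) (Fin n) ℂ} (hZ : IsUnit Z) (hZ' : IsUnit Z') :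
    ‖SZ Z' - SZ Z‖ ≤ 1 / 2 * (max ‖(GG Z')⁻¹‖ ‖(GG Z)⁻¹‖ * ‖GG Z' - GG Z‖) := by
  have hG := GG_posDef hZ
  have hG' := GG_posDef hZ'
  have hd : IsUnit (GG Z).det := (Matrix.isUnit_iff_isUnit_det _).1 hG.isUnit
  have hd' : IsUnit (GG Z').det := (Matrix.isUnit_iff_isUnit_det _).1 hG'.isUnit
  have h := Matrix.isStrictlyPositive_iff_posDef.2 hG
  have h' := Matrix.isStrictlyPositive_iff_posDef.2 hG'
  have e : SZ Z' - SZ Z = (1 / 2 : ℂ) • (CFC.log (GG Z') - CFC.log (GG Z)) := by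
    rw [smul_sub, ← mlog_eq hG, ← mlog_eq hG']; rfl
  rw [e, norm_smul]
  have h2 : ‖(1 / 2 : ℂ)‖ = 1 / 2 := by simp
  rw [h2]
  gcongr
  refine aux_log h' h ((norm_nonneg _).trans (le_max_left _ _)) ?_ ?_
  · exact aux_one_le h (Matrix.mul_nonsing_inv _ hd) (le_max_right _ _)
  · exact aux_one_le h' (Matrix.mul_nonsing_inv _ hd') (le_max_left _ _)

lemma aux_real {r w b z c : ℝ} (hr : 0 ≤ r) (hb : 0 ≤ b) (hz : 0 ≤ z) (hc : 0 ≤ c)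
    (hrw : r ≤ w) (hck : c ≤ (z * w) ^ 2) :
    r * r * (b * (z * (1 + c * c))) ≤ r * (b * (z * w) * (1 + (z * w) ^ 4)) := by
  have hw : 0 ≤ w := hr.trans hrw
  calc r * r * (b * (z * (1 + c * c)))
      ≤ r * w * (b * (z * (1 + (z * w) ^ 2 * (z * w) ^ 2))) := by gcongr
    _ = _ := by ring

end finalpart

/-- first order perturbation bound for `S(Z) = (1/2) log(Z*Z # conj(Z*Z))`:
for every `η > 0`, nearby invertible `Z̃` satisfy
`‖S(Z̃) − S(Z)‖ ≤ (‖ρ₂(Z)⁻¹‖ k(Z) + η) ‖Z̃ − Z‖`. -/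
theorem stmt9 {n : ℕ} (hn : 0 < n) (Z : Matrix (Fin n) (Fin n) ℂ) (hZ : IsUnit Z) :
    ∀ η : ℝ, 0 < η → ∃ ε : ℝ, 0 < ε ∧
      ∀ Z' : Matrix (Fin n) (Fin n) ℂ, IsUnit Z' → ‖Z' - Z‖ < ε →
        ‖SZ Z' - SZ Z‖ ≤ (‖(rho2 Z)⁻¹‖ * kZ Z + η) * ‖Z' - Z‖ := by
  intro η hη
  have hG := GG_posDef hZ
  have hA := posDef_ctmul hZ
  have hCZ : CZ Z = (Zᴴ * Z)⁻¹ * GG Z := rfl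
  have hCs : ‖GG Z * (Zᴴ * Z)⁻¹‖ = ‖CZ Z‖ := by
    rw [← Matrix.l2_opNorm_conjTranspose, Matrix.conjTranspose_mul, hA.inv.1.eq, hG.1.eq, hCZ]
  set κ := beta Z * ‖(Zᴴ * Z)⁻¹‖ with hκ
  -- the local Lipschitz factor
  let f : Matrix (Fin n) (Fin n) ℂ → ℝ := fun X =>
    1 / 2 * (max ‖(GG X)⁻¹‖ ‖(GG Z)⁻¹‖ * (beta Z * ((‖X‖ + ‖Z‖) *
      (1 + ‖GG X * (Xᴴ * X)⁻¹‖ * ‖(Zᴴ * Z)⁻¹ * GG X‖)) / (1 - κ * ‖GG X - GG Z‖)))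
  have cG : ContinuousAt (GG (n := n)) Z := GG_continuousAt hZ
  have cD : ContinuousAt (fun X : Matrix (Fin n) (Fin n) ℂ => 1 - κ * ‖GG X - GG Z‖) Z :=
    continuousAt_const.sub (continuousAt_const.mul (cG.sub continuousAt_const).norm)
  have cAi : ContinuousAt (fun X : Matrix (Fin n) (Fin n) ℂ => (Xᴴ * X)⁻¹) Z :=
    ContinuousAt.comp (f := fun X : Matrix (Fin n) (Fin n) ℂ => Xᴴ * X)
      (inv_continuousAt hA.isUnit) (by fun_prop)
  have cGi : ContinuousAt (fun X : Matrix (Fin n) (Fin n) ℂ => (GG X)⁻¹) Z :=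
    ContinuousAt.comp (f := GG (n := n)) (inv_continuousAt hG.isUnit) cG
  have cf : ContinuousAt f Z := by
    refine continuousAt_const.mul ((cGi.norm.max continuousAt_const).mul (ContinuousAt.div ?_ cD ?_))
    · refine continuousAt_const.mul (ContinuousAt.mul ?_ ?_)
      · exact continuousAt_id.norm.add continuousAt_const
      · exact continuousAt_const.add ((cG.mul cAi).norm.mul (continuousAt_const.mul cG).norm)
    · simp
  have hfZ : f Z ≤ ‖(rho2 Z)⁻¹‖ * kZ Z := by
    have h1 : f Z = ‖(GG Z)⁻¹‖ * (beta Z * (‖Z‖ * (1 + ‖CZ Z‖ * ‖CZ Z‖))) := by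
      simp only [f, max_self, hCs, ← hCZ, sub_self, norm_zero, mul_zero, sub_zero, div_one]
      ring
    have hb := beta_nonneg Z
    have hr := norm_rho2inv hZ
    have hle : ‖(rho2 Z)⁻¹‖ ≤ ‖Z⁻¹‖ := by
      have h2 := norm_GGinv hZ
      rw [hr] at h2
      exact abs_le_of_sq_le_sq' (by nlinarith) (norm_nonneg _) |>.2
    have hc := norm_CZ hZ
    rw [h1, hr, kZ]
    exact aux_real (norm_nonneg _) hb (norm_nonneg _) (norm_nonneg _) hle hc
  have ev1 : ∀ᶠ X in nhds Z, f X < ‖(rho2 Z)⁻¹‖ * kZ Z + η :=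
    cf.eventually_lt continuousAt_const (by linarith)
  have ev2 : ∀ᶠ X in nhds Z, 0 < 1 - κ * ‖GG X - GG Z‖ :=
    continuousAt_const.eventually_lt cD (by simp)
  obtain ⟨ε, hε, hball⟩ := Metric.eventually_nhds_iff.1 (ev1.and ev2)
  refine ⟨ε, hε, fun Z' hZ' hd => ?_⟩
  obtain ⟨hf, hpos⟩ := hball (by rwa [dist_eq_norm])
  have hdG := norm_dG hZ hZ'
  have hG2 : ‖GG Z' - GG Z‖ ≤ beta Z * ((‖Z'‖ + ‖Z‖) *
      (1 + ‖GG Z' * (Z'ᴴ * Z')⁻¹‖ * ‖(Zᴴ * Z)⁻¹ * GG Z'‖)) / (1 - κ * ‖GG Z' - GG Z‖)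
        * ‖Z' - Z‖ := by
    rw [div_mul_eq_mul_div, le_div_iff₀ hpos, hκ]
    linarith
  calc _ ≤ _ := norm_dS hZ hZ'
    _ ≤ f Z' * ‖Z' - Z‖ := by
      simp only [f]
      rw [mul_assoc, mul_assoc]
      refine mul_le_mul_of_nonneg_left ?_ (by norm_num)
      exact mul_le_mul_of_nonneg_left hG2 ((norm_nonneg _).trans (le_max_left _ _))
    _ ≤ _ := mul_le_mul_of_nonneg_right hf.le (norm_nonneg _)
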